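/- arXiv:1605.03927 — 7 statements merged into one kernel-verified Lean document; each statement's English description precedes it below -/
import Mathlib

section
/- In the abstract Hilbert optimal-control setting, the sign identity ⟨ι p̄ − ι p̃, ũ − ū⟩_H = −‖ι ȳ − ι ỹ‖_H² holds, and in particular ⟨ι p̄ − ι p̃, ũ − ū⟩_H ≤ 0. -/
open MeasureTheory
open scoped InnerProductSpace

/-- In the abstract Hilbert optimal-control setting, the sign identity
`⟪ι p̄ − ι p̃, ũ − ū⟫ = −‖ι ȳ − ι ỹ‖²` holds; in particular `⟪ι p̄ − ι p̃, ũ − ū⟫ ≤ 0`. -/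
theorem sign_identity
    {Ω : Type*} [MeasurableSpace Ω] (μ : Measure Ω) [IsFiniteMeasure μ]
    (a b : ℝ) (hab : a < b)
    (Pi : Lp ℝ 2 μ → Lp ℝ 2 μ)
    (hPi : ∀ w : Lp ℝ 2 μ, (⇑(Pi w)) =ᵐ[μ] fun x => min b (max a (w x)))
    (κ ϑ : ℝ) (hκ : 0 < κ) (hϑ : 0 < ϑ)
    {V : Type*} [NormedAddCommGroup V] [InnerProductSpace ℝ V]
    (ι : V →ₗ[ℝ] Lp ℝ 2 μ)
    (hι : ∀ v : V, ‖ι v‖ ≤ (Real.sqrt κ)⁻¹ * ‖v‖)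
    (B Bstar : V →ₗ[ℝ] V →ₗ[ℝ] ℝ)
    (hBstar : ∀ w v : V, Bstar w v = B v w)
    (hBcoer : ∀ v : V, B v v = ‖v‖ ^ 2)
    (f yΩ : Lp ℝ 2 μ)
    (ybar pbar : V) (ubar : Lp ℝ 2 μ)
    (hubar_mem : ∀ᵐ x ∂μ, a ≤ ubar x ∧ ubar x ≤ b)
    (hstate : ∀ v : V, B ybar v = ⟪f + ubar, ι v⟫_ℝ)
    (hadjoint : ∀ w : V, Bstar pbar w = ⟪ι ybar - yΩ, ι w⟫_ℝ)
    (hVI : ∀ u : Lp ℝ 2 μ, (∀ᵐ x ∂μ, a ≤ u x ∧ u x ≤ b) →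
        0 ≤ ⟪ι pbar + ϑ • ubar, u - ubar⟫_ℝ)
    (yT pT : V) (uT : Lp ℝ 2 μ)
    (huT_mem : ∀ᵐ x ∂μ, a ≤ uT x ∧ uT x ≤ b)
    (utilde : Lp ℝ 2 μ) (hutilde : utilde = Pi (-ϑ⁻¹ • ι pT))
    (ηct : ℝ) (hηct : ηct = ‖uT - utilde‖)
    (yhat phat ytilde ptilde : V)
    (hyhat : ∀ v : V, B yhat v = ⟪f + uT, ι v⟫_ℝ)
    (hphat : ∀ w : V, Bstar phat w = ⟪ι yT - yΩ, ι w⟫_ℝ)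
    (hytilde : ∀ v : V, B ytilde v = ⟪f + utilde, ι v⟫_ℝ)
    (hptilde : ∀ w : V, Bstar ptilde w = ⟪ι ytilde - yΩ, ι w⟫_ℝ)
    (ηst ηad : ℝ) (hηst0 : 0 ≤ ηst) (hηad0 : 0 ≤ ηad)
    (hηst : ‖yhat - yT‖ ≤ ηst) (hηad : ‖phat - pT‖ ≤ ηad) :
    ⟪ι pbar - ι ptilde, utilde - ubar⟫_ℝ = -‖ι ybar - ι ytilde‖ ^ 2
    ∧ ⟪ι pbar - ι ptilde, utilde - ubar⟫_ℝ ≤ 0 := by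
  have hstate_diff : B (ytilde - ybar) (pbar - ptilde)
      = ⟪utilde - ubar, ι pbar - ι ptilde⟫_ℝ := by
    rw [LinearMap.map_sub₂, hytilde, hstate, ← inner_sub_left, map_sub,
      add_sub_add_left_eq_sub]
  have hadjoint_diff : Bstar (pbar - ptilde) (ytilde - ybar)
      = ⟪ι ybar - ι ytilde, ι ytilde - ι ybar⟫_ℝ := by
    rw [LinearMap.map_sub₂, hadjoint, hptilde, ← inner_sub_left, map_sub,
      sub_sub_sub_cancel_right]
  have hsign : ⟪ι pbar - ι ptilde, utilde - ubar⟫_ℝ = -‖ι ybar - ι ytilde‖ ^ 2 := by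
    rw [real_inner_comm, ← hstate_diff, ← hBstar, hadjoint_diff,
      ← neg_sub (ι ybar) (ι ytilde), inner_neg_right, real_inner_self_eq_norm_sq]
  exact ⟨hsign, hsign.trans_le (neg_nonpos.mpr (sq_nonneg _))⟩
end

section
/- In the abstract Hilbert optimal-control setting, the error in the control satisfies ‖ū − u_T‖_H² ≤ (8/(ϑ²κ³)) η_st² + (4/(ϑ²κ)) η_ad² + (2 + 8/(ϑ²κ⁴)) η_ct². -/
open MeasureTheory
open scoped InnerProductSpace

/-- The variational inequality of the projection onto an interval. -/
lemma clamp_sub_mul_sub_nonneg {a b : ℝ} (w t : ℝ) (hat : a ≤ t) (htb : t ≤ b) :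
    0 ≤ (min b (max a w) - w) * (t - min b (max a w)) := by
  rcases le_total w a with h | h
  · rw [max_eq_left h, min_eq_right (hat.trans htb)]
    exact mul_nonneg (by linarith) (by linarith)
  · rw [max_eq_right h]
    rcases le_total b w with h' | h'
    · rw [min_eq_left h']
      exact mul_nonneg_of_nonpos_of_nonpos (by linarith) (by linarith)
    · simp [min_eq_right h']

/-- The variational inequality of the pointwise projection onto `[a, b]` in `L²`. -/
lemma inner_clamp_sub_nonneg {Ω : Type*} [MeasurableSpace Ω] {μ : Measure Ω} {a b : ℝ}
    {w p u : Lp ℝ 2 μ} (hp : (⇑p) =ᵐ[μ] fun x => min b (max a (w x)))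
    (hu : ∀ᵐ x ∂μ, a ≤ u x ∧ u x ≤ b) : 0 ≤ ⟪p - w, u - p⟫_ℝ := by
  rw [L2.inner_def]
  apply integral_nonneg_of_ae
  filter_upwards [hp, hu, Lp.coeFn_sub p w, Lp.coeFn_sub u p] with x hpx hux h₁ h₂
  rw [h₁, h₂]
  simp only [Pi.sub_apply, Pi.zero_apply, hpx, RCLike.inner_apply, conj_trivial]
  rw [mul_comm]
  exact clamp_sub_mul_sub_nonneg (w x) (u x) hux.1 hux.2

/-- The energy estimate for a functional of the form `v ↦ ⟪g, ι v⟫`. -/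
lemma norm_le_of_energy_eq_inner {V H : Type*} [NormedAddCommGroup V]
    [NormedAddCommGroup H] [InnerProductSpace ℝ H] {ι : V → H} {c : ℝ}
    (hc : 0 ≤ c) (hι : ∀ v, ‖ι v‖ ≤ c * ‖v‖) {d : V} {g : H} (hd : ‖d‖ ^ 2 = ⟪g, ι d⟫_ℝ) :
    ‖d‖ ≤ c * ‖g‖ := by
  rcases (norm_nonneg d).eq_or_lt with h | h
  · rw [← h]; positivity
  · have h₁ := real_inner_le_norm g (ι d)
    have h₂ := mul_le_mul_of_nonneg_left (hι d) (norm_nonneg g)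
    refine le_of_mul_le_mul_right ?_ h
    linarith

/-- In the abstract Hilbert optimal-control setting, the error in the control
satisfies `‖ū − u_T‖² ≤ (8/(ϑ²κ³)) η_st² + (4/(ϑ²κ)) η_ad² + (2 + 8/(ϑ²κ⁴)) η_ct²`. -/
theorem control_error_bound
    {Ω : Type*} [MeasurableSpace Ω] (μ : Measure Ω) [IsFiniteMeasure μ]
    (a b : ℝ) (hab : a < b)
    (Pi : Lp ℝ 2 μ → Lp ℝ 2 μ)
    (hPi : ∀ w : Lp ℝ 2 μ, (⇑(Pi w)) =ᵐ[μ] fun x => min b (max a (w x)))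
    (κ ϑ : ℝ) (hκ : 0 < κ) (hϑ : 0 < ϑ)
    {V : Type*} [NormedAddCommGroup V] [InnerProductSpace ℝ V]
    (ι : V →ₗ[ℝ] Lp ℝ 2 μ)
    (hι : ∀ v : V, ‖ι v‖ ≤ (Real.sqrt κ)⁻¹ * ‖v‖)
    (B Bstar : V →ₗ[ℝ] V →ₗ[ℝ] ℝ)
    (hBstar : ∀ w v : V, Bstar w v = B v w)
    (hBcoer : ∀ v : V, B v v = ‖v‖ ^ 2)
    (f yΩ : Lp ℝ 2 μ)
    (ybar pbar : V) (ubar : Lp ℝ 2 μ)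
    (hubar_mem : ∀ᵐ x ∂μ, a ≤ ubar x ∧ ubar x ≤ b)
    (hstate : ∀ v : V, B ybar v = ⟪f + ubar, ι v⟫_ℝ)
    (hadjoint : ∀ w : V, Bstar pbar w = ⟪ι ybar - yΩ, ι w⟫_ℝ)
    (hVI : ∀ u : Lp ℝ 2 μ, (∀ᵐ x ∂μ, a ≤ u x ∧ u x ≤ b) →
        0 ≤ ⟪ι pbar + ϑ • ubar, u - ubar⟫_ℝ)
    (yT pT : V) (uT : Lp ℝ 2 μ)
    (huT_mem : ∀ᵐ x ∂μ, a ≤ uT x ∧ uT x ≤ b)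
    (utilde : Lp ℝ 2 μ) (hutilde : utilde = Pi (-ϑ⁻¹ • ι pT))
    (ηct : ℝ) (hηct : ηct = ‖uT - utilde‖)
    (yhat phat ytilde ptilde : V)
    (hyhat : ∀ v : V, B yhat v = ⟪f + uT, ι v⟫_ℝ)
    (hphat : ∀ w : V, Bstar phat w = ⟪ι yT - yΩ, ι w⟫_ℝ)
    (hytilde : ∀ v : V, B ytilde v = ⟪f + utilde, ι v⟫_ℝ)
    (hptilde : ∀ w : V, Bstar ptilde w = ⟪ι ytilde - yΩ, ι w⟫_ℝ)
    (ηst ηad : ℝ) (hηst0 : 0 ≤ ηst) (hηad0 : 0 ≤ ηad)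
    (hηst : ‖yhat - yT‖ ≤ ηst) (hηad : ‖phat - pT‖ ≤ ηad) :
    ‖ubar - uT‖ ^ 2 ≤ 8 / (ϑ ^ 2 * κ ^ 3) * ηst ^ 2 + 4 / (ϑ ^ 2 * κ) * ηad ^ 2
      + (2 + 8 / (ϑ ^ 2 * κ ^ 4)) * ηct ^ 2 := by
  obtain ⟨s, hs⟩ : ∃ s, s = (Real.sqrt κ)⁻¹ := ⟨_, rfl⟩
  have hs0 : 0 ≤ s := by rw [hs]; positivity
  have hs2 : s ^ 2 = κ⁻¹ := by rw [hs, inv_pow, Real.sq_sqrt hκ.le]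
  rw [← hs] at hι
  have hutilde_ae : (⇑utilde) =ᵐ[μ] fun x => min b (max a ((-ϑ⁻¹ • ι pT) x)) :=
    hutilde ▸ hPi _
  have hutilde_mem : ∀ᵐ x ∂μ, a ≤ utilde x ∧ utilde x ≤ b := by
    filter_upwards [hutilde_ae] with x hx
    rw [hx]
    exact ⟨le_min hab.le (le_max_left _ _), min_le_left _ _⟩
  have hy : ‖yhat - ytilde‖ ≤ s * ηct := by
    rw [hηct]
    refine norm_le_of_energy_eq_inner hs0 hι ?_
    rw [← hBcoer, map_sub B, LinearMap.sub_apply, hyhat, hytilde, ← inner_sub_left,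
      add_sub_add_left_eq_sub]
  have hp : ‖phat - ptilde‖ ≤ s * ‖ι (yT - ytilde)‖ := by
    refine norm_le_of_energy_eq_inner hs0 hι ?_
    rw [← hBcoer, ← hBstar, map_sub Bstar, LinearMap.sub_apply, hphat, hptilde,
      ← inner_sub_left, sub_sub_sub_cancel_right, ← map_sub ι]
  have hyT : ‖yT - ytilde‖ ≤ ηst + s * ηct := by
    have h := norm_sub_le_norm_sub_add_norm_sub yT yhat ytilde
    rw [norm_sub_rev yT yhat] at h
    linarith
  have hpT : ‖pT - ptilde‖ ≤ ηad + s ^ 2 * (ηst + s * ηct) := by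
    have h := norm_sub_le_norm_sub_add_norm_sub pT phat ptilde
    rw [norm_sub_rev pT phat] at h
    have h' : s * ‖ι (yT - ytilde)‖ ≤ s * (s * (ηst + s * ηct)) := by
      gcongr
      exact (hι _).trans (by gcongr)
    linarith
  have hdual : ⟪ι (ptilde - pbar), ubar - utilde⟫_ℝ ≤ 0 := by
    have h : ⟪ι (ptilde - pbar), ubar - utilde⟫_ℝ = -⟪ι (ybar - ytilde), ι (ybar - ytilde)⟫_ℝ := by
      rw [real_inner_comm, ← add_sub_add_left_eq_sub ubar utilde f, inner_sub_left, ← hstate,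
        ← hytilde, ← LinearMap.sub_apply, ← map_sub B, ← hBstar, map_sub Bstar,
        LinearMap.sub_apply, hptilde, hadjoint, ← inner_sub_left, sub_sub_sub_cancel_right,
        ← map_sub ι, ← neg_sub ybar ytilde, map_neg, inner_neg_left]
    rw [h, neg_nonpos]
    exact real_inner_self_nonneg
  have hproj : 0 ≤ ⟪ι pT + ϑ • utilde, ubar - utilde⟫_ℝ := by
    have h := mul_nonneg hϑ.le (inner_clamp_sub_nonneg hutilde_ae hubar_mem)
    rwa [← real_inner_smul_left, smul_sub, smul_smul, mul_neg, mul_inv_cancel₀ hϑ.ne',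
      neg_one_smul, sub_neg_eq_add, add_comm] at h
  have hkey : ϑ * ‖ubar - utilde‖ ^ 2 ≤ ⟪ι (pT - ptilde), ubar - utilde⟫_ℝ := by
    have h := hVI utilde hutilde_mem
    rw [← neg_sub ubar utilde, inner_neg_right] at h
    rw [← real_inner_self_eq_norm_sq]
    simp only [map_sub, inner_sub_left, inner_add_left, real_inner_smul_left] at *
    linarith
  have hcontrol : ‖ubar - utilde‖ ≤ ϑ⁻¹ * ‖ι (pT - ptilde)‖ := by
    rcases (norm_nonneg (ubar - utilde)).eq_or_lt with h | h
    · rw [← h]; positivity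
    · rw [le_inv_mul_iff₀ hϑ]
      refine le_of_mul_le_mul_right ?_ h
      linarith [real_inner_le_norm (ι (pT - ptilde)) (ubar - utilde)]
  have hbound : ‖ubar - utilde‖ ≤ ϑ⁻¹ * (s * (ηad + s ^ 2 * (ηst + s * ηct))) := by
    refine hcontrol.trans ?_
    gcongr
    exact (hι _).trans (by gcongr)
  have hsq : ‖ubar - utilde‖ ^ 2 ≤
      ϑ⁻¹ ^ 2 * s ^ 2 * (2 * ηad ^ 2 + 4 * (s ^ 2) ^ 2 * (ηst ^ 2 + s ^ 2 * ηct ^ 2)) := by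
    refine (pow_le_pow_left₀ (norm_nonneg _) hbound 2).trans ?_
    rw [mul_pow, mul_pow, ← mul_assoc]
    gcongr
    nlinarith [sq_nonneg (ηad - s ^ 2 * (ηst + s * ηct)),
      sq_nonneg (s ^ 2 * (ηst - s * ηct))]
  have htri : ‖ubar - uT‖ ^ 2 ≤ 2 * ‖ubar - utilde‖ ^ 2 + 2 * ηct ^ 2 := by
    have h := norm_sub_le_norm_sub_add_norm_sub ubar utilde uT
    rw [norm_sub_rev utilde uT, ← hηct] at h
    refine (pow_le_pow_left₀ (norm_nonneg _) h 2).trans ?_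
    linarith [add_sq_le (a := ‖ubar - utilde‖) (b := ηct)]
  rw [hs2] at hsq
  calc ‖ubar - uT‖ ^ 2
      ≤ 2 * (ϑ⁻¹ ^ 2 * κ⁻¹ * (2 * ηad ^ 2 + 4 * κ⁻¹ ^ 2 * (ηst ^ 2 + κ⁻¹ * ηct ^ 2)))
        + 2 * ηct ^ 2 := by linarith
    _ = _ := by field_simp; ring
end

section
/- Global reliability (abstract form of Theorem 4.1): in the abstract Hilbert optimal-control setting, the total error satisfies ‖ȳ − y_T‖_V² + ‖p̄ − p_T‖_V² + ‖ū − u_T‖_H² ≤ C_st η_st² + C_ad η_ad² + C_ct η_ct², where C_st = 2 + 4/κ² + (8/(ϑ²κ⁶))(κ³ + 2κ² + 4), C_ad = 2 + (4/(ϑ²κ⁴))(κ³ + 2κ² + 4), and C_ct = 2 + 4/κ + 8/κ³ + (8/(ϑ²κ⁷))(κ³ + 2κ² + 4). -/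
open MeasureTheory
open scoped InnerProductSpace

/-- The variational inequality characterising the pointwise projection onto `[a, b]`. -/
lemma min_max_projection_nonneg {a b s t : ℝ} (hat : a ≤ t) (htb : t ≤ b) :
    0 ≤ (t - min b (max a s)) * (min b (max a s) - s) := by
  have hab := hat.trans htb
  rcases le_total s a with hs | hs
  · rw [max_eq_left hs, min_eq_right hab]
    exact mul_nonneg (by linarith) (by linarith)
  · rw [max_eq_right hs]
    rcases le_total s b with hsb | hsb
    · simp [min_eq_right hsb]
    · rw [min_eq_left hsb]
      exact mul_nonneg_of_nonpos_of_nonpos (by linarith) (by linarith)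

lemma inner_projection_sub_nonneg {Ω : Type*} [MeasurableSpace Ω] {μ : Measure Ω} {a b : ℝ}
    {w p u : Lp ℝ 2 μ} (hp : p =ᵐ[μ] fun x => min b (max a (w x)))
    (hu : ∀ᵐ x ∂μ, a ≤ u x ∧ u x ≤ b) : 0 ≤ ⟪p - w, u - p⟫_ℝ := by
  rw [L2.inner_def]
  refine integral_nonneg_of_ae ?_
  filter_upwards [hp, hu, Lp.coeFn_sub p w, Lp.coeFn_sub u p] with x hpx hux hpw hup
  rw [hpw, hup, Pi.sub_apply, Pi.sub_apply, hpx]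
  simpa [mul_comm] using min_max_projection_nonneg (s := w x) hux.1 hux.2

lemma norm_sq_sub_le_two_mul {E : Type*} [SeminormedAddCommGroup E] (x y z : E) :
    ‖x - z‖ ^ 2 ≤ 2 * ‖x - y‖ ^ 2 + 2 * ‖y - z‖ ^ 2 := by
  have h := norm_sub_le_norm_sub_add_norm_sub x y z
  have h' := pow_le_pow_left₀ (norm_nonneg _) h 2
  nlinarith [sq_nonneg (‖x - y‖ - ‖y - z‖)]

lemma le_of_sq_le_mul {x y : ℝ} (hy : 0 ≤ y) (h : x ^ 2 ≤ y * x) : x ≤ y := by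
  by_contra! hlt
  nlinarith

/-- Stability of the solution map of a coercive variational problem. -/
lemma norm_le_of_coercive {V H : Type*} [NormedAddCommGroup V] [InnerProductSpace ℝ V]
    [NormedAddCommGroup H] [InnerProductSpace ℝ H] {c : ℝ} (hc : 0 ≤ c) {ι : V →ₗ[ℝ] H}
    (hι : ∀ v, ‖ι v‖ ≤ c * ‖v‖) {B : V →ₗ[ℝ] V →ₗ[ℝ] ℝ} (hB : ∀ v, B v v = ‖v‖ ^ 2)
    {y z : V} {g h : H} (hy : ∀ v, B y v = ⟪g, ι v⟫_ℝ) (hz : ∀ v, B z v = ⟪h, ι v⟫_ℝ) :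
    ‖y - z‖ ≤ c * ‖g - h‖ := by
  refine le_of_sq_le_mul (by positivity) ?_
  calc ‖y - z‖ ^ 2 = ⟪g - h, ι (y - z)⟫_ℝ := by
        rw [← hB, map_sub B, LinearMap.sub_apply, hy, hz, inner_sub_left]
    _ ≤ ‖g - h‖ * ‖ι (y - z)‖ := real_inner_le_norm _ _
    _ ≤ ‖g - h‖ * (c * ‖y - z‖) := by gcongr; exact hι _
    _ = c * ‖g - h‖ * ‖y - z‖ := by ring

/-- Global reliability (abstract form of Theorem 4.1): the total error
satisfies `‖ȳ − y_T‖² + ‖p̄ − p_T‖² + ‖ū − u_T‖² ≤ C_st η_st² + C_ad η_ad² + C_ct η_ct²` with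
`C_st = 2 + 4/κ² + (8/(ϑ²κ⁶))(κ³ + 2κ² + 4)`, `C_ad = 2 + (4/(ϑ²κ⁴))(κ³ + 2κ² + 4)` and
`C_ct = 2 + 4/κ + 8/κ³ + (8/(ϑ²κ⁷))(κ³ + 2κ² + 4)`. -/
theorem global_reliability
    {Ω : Type*} [MeasurableSpace Ω] (μ : Measure Ω) [IsFiniteMeasure μ]
    (a b : ℝ) (hab : a < b)
    (Pi : Lp ℝ 2 μ → Lp ℝ 2 μ)
    (hPi : ∀ w : Lp ℝ 2 μ, (⇑(Pi w)) =ᵐ[μ] fun x => min b (max a (w x)))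
    (κ ϑ : ℝ) (hκ : 0 < κ) (hϑ : 0 < ϑ)
    {V : Type*} [NormedAddCommGroup V] [InnerProductSpace ℝ V]
    (ι : V →ₗ[ℝ] Lp ℝ 2 μ)
    (hι : ∀ v : V, ‖ι v‖ ≤ (Real.sqrt κ)⁻¹ * ‖v‖)
    (B Bstar : V →ₗ[ℝ] V →ₗ[ℝ] ℝ)
    (hBstar : ∀ w v : V, Bstar w v = B v w)
    (hBcoer : ∀ v : V, B v v = ‖v‖ ^ 2)
    (f yΩ : Lp ℝ 2 μ)
    (ybar pbar : V) (ubar : Lp ℝ 2 μ)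
    (hubar_mem : ∀ᵐ x ∂μ, a ≤ ubar x ∧ ubar x ≤ b)
    (hstate : ∀ v : V, B ybar v = ⟪f + ubar, ι v⟫_ℝ)
    (hadjoint : ∀ w : V, Bstar pbar w = ⟪ι ybar - yΩ, ι w⟫_ℝ)
    (hVI : ∀ u : Lp ℝ 2 μ, (∀ᵐ x ∂μ, a ≤ u x ∧ u x ≤ b) →
        0 ≤ ⟪ι pbar + ϑ • ubar, u - ubar⟫_ℝ)
    (yT pT : V) (uT : Lp ℝ 2 μ)
    (huT_mem : ∀ᵐ x ∂μ, a ≤ uT x ∧ uT x ≤ b)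
    (utilde : Lp ℝ 2 μ) (hutilde : utilde = Pi (-ϑ⁻¹ • ι pT))
    (ηct : ℝ) (hηct : ηct = ‖uT - utilde‖)
    (yhat phat ytilde ptilde : V)
    (hyhat : ∀ v : V, B yhat v = ⟪f + uT, ι v⟫_ℝ)
    (hphat : ∀ w : V, Bstar phat w = ⟪ι yT - yΩ, ι w⟫_ℝ)
    (hytilde : ∀ v : V, B ytilde v = ⟪f + utilde, ι v⟫_ℝ)
    (hptilde : ∀ w : V, Bstar ptilde w = ⟪ι ytilde - yΩ, ι w⟫_ℝ)
    (ηst ηad : ℝ) (hηst0 : 0 ≤ ηst) (hηad0 : 0 ≤ ηad)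
    (hηst : ‖yhat - yT‖ ≤ ηst) (hηad : ‖phat - pT‖ ≤ ηad) :
    ‖ybar - yT‖ ^ 2 + ‖pbar - pT‖ ^ 2 + ‖ubar - uT‖ ^ 2
      ≤ (2 + 4 / κ ^ 2 + 8 / (ϑ ^ 2 * κ ^ 6) * (κ ^ 3 + 2 * κ ^ 2 + 4)) * ηst ^ 2
        + (2 + 4 / (ϑ ^ 2 * κ ^ 4) * (κ ^ 3 + 2 * κ ^ 2 + 4)) * ηad ^ 2
        + (2 + 4 / κ + 8 / κ ^ 3 + 8 / (ϑ ^ 2 * κ ^ 7) * (κ ^ 3 + 2 * κ ^ 2 + 4)) * ηct ^ 2 := by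
  have hc : 0 ≤ (Real.sqrt κ)⁻¹ := by positivity
  have hc2 : (Real.sqrt κ)⁻¹ ^ 2 = 1 / κ := by
    rw [inv_pow, Real.sq_sqrt hκ.le, one_div]
  have hBstar_coer : ∀ v, Bstar v v = ‖v‖ ^ 2 := fun v => by rw [hBstar, hBcoer]
  have state_stability : ∀ {y z : V} {g h : Lp ℝ 2 μ}, (∀ v, B y v = ⟪f + g, ι v⟫_ℝ) →
      (∀ v, B z v = ⟪f + h, ι v⟫_ℝ) → ‖y - z‖ ^ 2 ≤ 1 / κ * ‖g - h‖ ^ 2 := by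
    intro y z g h hy hz
    have hyz := norm_le_of_coercive hc hι hBcoer hy hz
    rw [add_sub_add_left_eq_sub] at hyz
    rw [← hc2, ← mul_pow]
    gcongr
  have adjoint_stability : ∀ {p q y z : V}, (∀ w, Bstar p w = ⟪ι y - yΩ, ι w⟫_ℝ) →
      (∀ w, Bstar q w = ⟪ι z - yΩ, ι w⟫_ℝ) → ‖p - q‖ ^ 2 ≤ (1 / κ) ^ 2 * ‖y - z‖ ^ 2 := by
    intro p q y z hp hq
    have hpq := norm_le_of_coercive hc hι hBstar_coer hp hq
    rw [sub_sub_sub_cancel_right, ← map_sub] at hpq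
    rw [← hc2, ← mul_pow]
    gcongr
    exact hpq.trans ((mul_le_mul_of_nonneg_left (hι _) hc).trans_eq (by ring))
  have hutilde_ae := hPi (-ϑ⁻¹ • ι pT)
  rw [← hutilde] at hutilde_ae
  have hutilde_mem : ∀ᵐ x ∂μ, a ≤ utilde x ∧ utilde x ≤ b := by
    filter_upwards [hutilde_ae] with x hx
    rw [hx]
    exact ⟨le_min hab.le (le_max_left _ _), min_le_left _ _⟩
  have hVI_tilde : 0 ≤ ⟪ι pT + ϑ • utilde, ubar - utilde⟫_ℝ := by
    have hscale : ι pT + ϑ • utilde = ϑ • (utilde - -ϑ⁻¹ • ι pT) := by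
      rw [smul_sub, smul_smul, mul_neg, mul_inv_cancel₀ hϑ.ne', neg_one_smul]
      abel
    rw [hscale, real_inner_smul_left]
    exact mul_nonneg hϑ.le (inner_projection_sub_nonneg hutilde_ae hubar_mem)
  have hmonotone : ⟪ι (pbar - ptilde), utilde - ubar⟫_ℝ ≤ 0 := by
    have hstate_diff : ⟪ι (pbar - ptilde), utilde - ubar⟫_ℝ
        = B (ytilde - ybar) (pbar - ptilde) := by
      rw [map_sub B, LinearMap.sub_apply, hytilde, hstate, ← inner_sub_left,
        add_sub_add_left_eq_sub, real_inner_comm]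
    rw [hstate_diff, ← hBstar, map_sub Bstar, LinearMap.sub_apply, hadjoint, hptilde,
      ← inner_sub_left, sub_sub_sub_cancel_right, ← map_sub, ← neg_sub ytilde ybar, map_neg,
      inner_neg_left, neg_nonpos]
    exact real_inner_self_nonneg
  have hcontrol : ϑ * ‖ubar - utilde‖ ^ 2 ≤ ⟪ι (ptilde - pT), utilde - ubar⟫_ℝ := by
    have hVI_bar := hVI utilde hutilde_mem
    have hsq := real_inner_self_eq_norm_sq (ubar - utilde)
    simp only [map_sub, inner_sub_left, inner_sub_right, inner_add_left, real_inner_smul_left]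
      at hVI_bar hVI_tilde hmonotone hsq ⊢
    rw [← hsq, real_inner_comm ubar utilde]
    rw [real_inner_comm ubar utilde] at hVI_tilde
    linarith
  have hcontrol_norm : ϑ * ‖ubar - utilde‖ ≤ (Real.sqrt κ)⁻¹ * ‖ptilde - pT‖ := by
    refine le_of_sq_le_mul (by positivity) ?_
    have hbound := hcontrol.trans ((real_inner_le_norm _ _).trans
      (mul_le_mul_of_nonneg_right (hι _) (norm_nonneg _)))
    rw [norm_sub_rev utilde] at hbound
    linarith [mul_le_mul_of_nonneg_left hbound hϑ.le]
  have hcontrol_sq : ‖ubar - utilde‖ ^ 2 ≤ 1 / ϑ ^ 2 * (1 / κ * ‖ptilde - pT‖ ^ 2) := by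
    have hsq := pow_le_pow_left₀ (by positivity) hcontrol_norm 2
    rw [mul_pow, mul_pow, hc2] at hsq
    rw [one_div_mul_eq_div, le_div_iff₀ (by positivity)]
    linarith
  have hst : ‖yhat - yT‖ ^ 2 ≤ ηst ^ 2 := by gcongr
  have had : ‖phat - pT‖ ^ 2 ≤ ηad ^ 2 := by gcongr
  have hytilde_error : ‖ytilde - yT‖ ^ 2 ≤ 2 * (1 / κ * ηct ^ 2) + 2 * ηst ^ 2 := by
    have hstab := state_stability hytilde hyhat
    rw [norm_sub_rev utilde, ← hηct] at hstab
    linarith [norm_sq_sub_le_two_mul ytilde yhat yT]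
  have hptilde_error : ‖ptilde - pT‖ ^ 2
      ≤ 2 * ((1 / κ) ^ 2 * (2 * (1 / κ * ηct ^ 2) + 2 * ηst ^ 2)) + 2 * ηad ^ 2 := by
    have hstab := (adjoint_stability hptilde hphat).trans
      (mul_le_mul_of_nonneg_left hytilde_error (by positivity))
    linarith [norm_sq_sub_le_two_mul ptilde phat pT]
  have hu : ‖ubar - uT‖ ^ 2 ≤ 2 * (1 / ϑ ^ 2 * (1 / κ * (2 * ((1 / κ) ^ 2 *
      (2 * (1 / κ * ηct ^ 2) + 2 * ηst ^ 2)) + 2 * ηad ^ 2))) + 2 * ηct ^ 2 := by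
    have htri := norm_sq_sub_le_two_mul ubar utilde uT
    rw [norm_sub_rev utilde, ← hηct] at htri
    have hmono : 1 / ϑ ^ 2 * (1 / κ * ‖ptilde - pT‖ ^ 2) ≤ 1 / ϑ ^ 2 * (1 / κ * (2 *
        ((1 / κ) ^ 2 * (2 * (1 / κ * ηct ^ 2) + 2 * ηst ^ 2)) + 2 * ηad ^ 2)) := by gcongr
    linarith
  have hy : ‖ybar - yT‖ ^ 2 ≤ 2 * (1 / κ * ‖ubar - uT‖ ^ 2) + 2 * ηst ^ 2 := by
    linarith [norm_sq_sub_le_two_mul ybar yhat yT, state_stability hstate hyhat]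
  have hp : ‖pbar - pT‖ ^ 2
      ≤ 2 * ((1 / κ) ^ 2 * (2 * (1 / κ * ‖ubar - uT‖ ^ 2) + 2 * ηst ^ 2)) + 2 * ηad ^ 2 := by
    have hstab := (adjoint_stability hadjoint hphat).trans
      (mul_le_mul_of_nonneg_left hy (by positivity))
    linarith [norm_sq_sub_le_two_mul pbar phat pT]
  calc ‖ybar - yT‖ ^ 2 + ‖pbar - pT‖ ^ 2 + ‖ubar - uT‖ ^ 2
      ≤ (2 + 4 / κ ^ 2) * ηst ^ 2 + 2 * ηad ^ 2
        + (1 + 2 / κ + 4 / κ ^ 3) * ‖ubar - uT‖ ^ 2 := by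
        refine (add_le_add_left (add_le_add hy hp) _).trans_eq ?_
        ring
    _ ≤ _ := add_le_add_right (mul_le_mul_of_nonneg_left hu (by positivity)) _
    _ = _ := by
        field_simp
        ring
end

section
/- In the abstract robust setting, let A_st, A_ad ≥ 0 satisfy ‖ŷ − y_T‖_R ≤ A_st and ‖p̂ − p_T‖_R ≤ A_ad. Then the error in the control satisfies ‖ū − u_T‖_H² ≤ (2 + 648/(ϑ²κ⁴)) η_ct² + (4/(ϑ²κ)) A_ad² + (72/(ϑ²κ³)) A_st². -/
open MeasureTheory
open scoped InnerProductSpace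

/-- The truncation to `[a, b]` satisfies the variational inequality of the metric projection
onto the set of functions with values in `[a, b]`. -/
theorem inner_truncation_sub_nonneg {Ω : Type*} [MeasurableSpace Ω] {μ : Measure Ω} {a b : ℝ}
    {w q u : Lp ℝ 2 μ} (hq : (⇑q) =ᵐ[μ] fun x => min b (max a (w x)))
    (hu : ∀ᵐ x ∂μ, a ≤ u x ∧ u x ≤ b) :
    0 ≤ ⟪q - w, u - q⟫_ℝ := by
  rw [L2.inner_def]
  apply integral_nonneg_of_ae
  filter_upwards [hq, hu, Lp.coeFn_sub q w, Lp.coeFn_sub u q] with x hqx ⟨hax, hxb⟩ h₁ h₂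
  rw [h₁, h₂]
  simp only [Pi.sub_apply, Pi.zero_apply, hqx, RCLike.inner_apply, conj_trivial]
  rcases le_total a (w x) with h | h
  · rw [max_eq_right h]
    rcases le_total b (w x) with h' | h'
    · rw [min_eq_left h']
      exact mul_nonneg_of_nonpos_of_nonpos (by linarith) (by linarith)
    · simp [min_eq_right h']
  · rw [max_eq_left h, min_eq_right (hax.trans hxb)]
    exact mul_nonneg (by linarith) (by linarith)

/-- Stability in `H` of the solution of a variational problem whose form satisfies an inf-sup
condition with constant `3`. -/
theorem norm_le_of_infsup {H V : Type*} [NormedAddCommGroup H] [InnerProductSpace ℝ H]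
    [AddCommGroup V] [Module ℝ V] {κ : ℝ} (hκ : 0 < κ) {NOm NR : V → ℝ}
    (hOmR : ∀ v, NOm v ≤ NR v) {ι : V →ₗ[ℝ] H}
    (hι : ∀ v, ‖ι v‖ ≤ (Real.sqrt κ)⁻¹ * NOm v) {B : V →ₗ[ℝ] V →ₗ[ℝ] ℝ}
    (hB : ∀ w : V, ∀ c : ℝ, (∀ v : V, B w v ≤ c * NOm v) → NR w ≤ 3 * c)
    {w : V} {h : H} (hw : ∀ v, B w v = ⟪h, ι v⟫_ℝ) :
    ‖ι w‖ ≤ 3 / κ * ‖h‖ := by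
  have hR : NR w ≤ 3 * (‖h‖ * (Real.sqrt κ)⁻¹) := by
    refine hB w _ fun v => ?_
    rw [hw, mul_assoc]
    exact (real_inner_le_norm _ _).trans (mul_le_mul_of_nonneg_left (hι v) (norm_nonneg h))
  have hsq : (Real.sqrt κ)⁻¹ * (Real.sqrt κ)⁻¹ = κ⁻¹ := by
    rw [← mul_inv, Real.mul_self_sqrt hκ.le]
  calc ‖ι w‖ ≤ (Real.sqrt κ)⁻¹ * NOm w := hι w
    _ ≤ (Real.sqrt κ)⁻¹ * (3 * (‖h‖ * (Real.sqrt κ)⁻¹)) := by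
      gcongr
      exact (hOmR w).trans hR
    _ = 3 * ‖h‖ * ((Real.sqrt κ)⁻¹ * (Real.sqrt κ)⁻¹) := by ring
    _ = 3 / κ * ‖h‖ := by rw [hsq]; ring

/-- In the abstract robust setting, with `A_st, A_ad ≥ 0` such that
`‖ŷ − y_T‖_R ≤ A_st` and `‖p̂ − p_T‖_R ≤ A_ad`, the error in the control satisfies
`‖ū − u_T‖² ≤ (2 + 648/(ϑ²κ⁴)) η_ct² + (4/(ϑ²κ)) A_ad² + (72/(ϑ²κ³)) A_st²`. -/
theorem robust_control_error_bound
    {Ω : Type*} [MeasurableSpace Ω] (μ : Measure Ω) [IsFiniteMeasure μ]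
    (a b : ℝ) (hab : a < b)
    (Pi : Lp ℝ 2 μ → Lp ℝ 2 μ)
    (hPi : ∀ w : Lp ℝ 2 μ, (⇑(Pi w)) =ᵐ[μ] fun x => min b (max a (w x)))
    (κ ϑ : ℝ) (hκ : 0 < κ) (hϑ : 0 < ϑ)
    {V : Type*} [AddCommGroup V] [Module ℝ V]
    (NOm NR : V → ℝ)
    (hNOm_add : ∀ v w : V, NOm (v + w) ≤ NOm v + NOm w)
    (hNOm_smul : ∀ (c : ℝ) (v : V), NOm (c • v) = |c| * NOm v)
    (hNOm_eq_zero : ∀ v : V, NOm v = 0 ↔ v = 0)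
    (hNR_add : ∀ v w : V, NR (v + w) ≤ NR v + NR w)
    (hNR_smul : ∀ (c : ℝ) (v : V), NR (c • v) = |c| * NR v)
    (hNR_eq_zero : ∀ v : V, NR v = 0 ↔ v = 0)
    (hOmR : ∀ v : V, NOm v ≤ NR v)
    (ι : V →ₗ[ℝ] Lp ℝ 2 μ)
    (hι : ∀ v : V, ‖ι v‖ ≤ (Real.sqrt κ)⁻¹ * NOm v)
    (B Bstar : V →ₗ[ℝ] V →ₗ[ℝ] ℝ)
    (hBstar : ∀ w v : V, Bstar w v = B v w)
    (hinfsupB : ∀ w : V, ∀ c : ℝ, (∀ v : V, B w v ≤ c * NOm v) → NR w ≤ 3 * c)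
    (hinfsupBstar : ∀ w : V, ∀ c : ℝ, (∀ v : V, Bstar w v ≤ c * NOm v) → NR w ≤ 3 * c)
    (f yΩ : Lp ℝ 2 μ)
    (ybar pbar : V) (ubar : Lp ℝ 2 μ)
    (hubar_mem : ∀ᵐ x ∂μ, a ≤ ubar x ∧ ubar x ≤ b)
    (hstate : ∀ v : V, B ybar v = ⟪f + ubar, ι v⟫_ℝ)
    (hadjoint : ∀ w : V, Bstar pbar w = ⟪ι ybar - yΩ, ι w⟫_ℝ)
    (hVI : ∀ u : Lp ℝ 2 μ, (∀ᵐ x ∂μ, a ≤ u x ∧ u x ≤ b) →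
        0 ≤ ⟪ι pbar + ϑ • ubar, u - ubar⟫_ℝ)
    (yT pT : V) (uT : Lp ℝ 2 μ)
    (huT_mem : ∀ᵐ x ∂μ, a ≤ uT x ∧ uT x ≤ b)
    (utilde : Lp ℝ 2 μ) (hutilde : utilde = Pi (-ϑ⁻¹ • ι pT))
    (ηct : ℝ) (hηct : ηct = ‖uT - utilde‖)
    (yhat phat ytilde ptilde : V)
    (hyhat : ∀ v : V, B yhat v = ⟪f + uT, ι v⟫_ℝ)
    (hphat : ∀ w : V, Bstar phat w = ⟪ι yT - yΩ, ι w⟫_ℝ)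
    (hytilde : ∀ v : V, B ytilde v = ⟪f + utilde, ι v⟫_ℝ)
    (hptilde : ∀ w : V, Bstar ptilde w = ⟪ι ytilde - yΩ, ι w⟫_ℝ)
    (Ast Aad : ℝ) (hAst0 : 0 ≤ Ast) (hAad0 : 0 ≤ Aad)
    (hAst : NR (yhat - yT) ≤ Ast) (hAad : NR (phat - pT) ≤ Aad) :
    ‖ubar - uT‖ ^ 2 ≤ (2 + 648 / (ϑ ^ 2 * κ ^ 4)) * ηct ^ 2
      + 4 / (ϑ ^ 2 * κ) * Aad ^ 2 + 72 / (ϑ ^ 2 * κ ^ 3) * Ast ^ 2 := by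
  have hsq : (Real.sqrt κ)⁻¹ ^ 2 = κ⁻¹ := by rw [inv_pow, Real.sq_sqrt hκ.le]
  have hιR : ∀ (v : V) (A : ℝ), NR v ≤ A → ‖ι v‖ ≤ (Real.sqrt κ)⁻¹ * A := fun v A hA =>
    (hι v).trans (mul_le_mul_of_nonneg_left ((hOmR v).trans hA) (by positivity))
  have hutilde_ae : (⇑utilde) =ᵐ[μ] fun x => min b (max a ((-ϑ⁻¹ • ι pT : Lp ℝ 2 μ) x)) :=
    hutilde ▸ hPi _
  have hutilde_mem : ∀ᵐ x ∂μ, a ≤ utilde x ∧ utilde x ≤ b := by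
    filter_upwards [hutilde_ae] with x hx
    rw [hx]
    exact ⟨le_min hab.le (le_max_left _ _), min_le_left _ _⟩
  have hproj : 0 ≤ ⟪ι pT + ϑ • utilde, ubar - utilde⟫_ℝ := by
    have h := mul_nonneg hϑ.le (inner_truncation_sub_nonneg hutilde_ae hubar_mem)
    rw [← real_inner_smul_left] at h
    rwa [smul_sub, smul_smul, mul_neg, mul_inv_cancel₀ hϑ.ne', neg_one_smul, sub_neg_eq_add,
      add_comm] at h
  -- The adjoint difference pairs with the control difference with a favourable sign.
  have hmono : ⟪ι (pbar - ptilde), utilde - ubar⟫_ℝ ≤ 0 := by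
    have h₁ : B (ytilde - ybar) (pbar - ptilde) = ⟪utilde - ubar, ι (pbar - ptilde)⟫_ℝ := by
      rw [map_sub B, LinearMap.sub_apply, hytilde, hstate, ← inner_sub_left]
      congr 1
      abel
    have h₂ : Bstar (pbar - ptilde) (ytilde - ybar)
        = ⟪ι (ybar - ytilde), ι (ytilde - ybar)⟫_ℝ := by
      rw [map_sub Bstar, LinearMap.sub_apply, hadjoint, hptilde, ← inner_sub_left, map_sub ι ybar]
      congr 1
      abel
    rw [real_inner_comm, ← h₁, ← hBstar, h₂, ← neg_sub ytilde ybar, map_neg, inner_neg_left]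
    exact neg_nonpos.2 real_inner_self_nonneg
  have hcontrol : ϑ * ‖utilde - ubar‖ ≤ ‖ι (ptilde - pT)‖ := by
    have h : ϑ * ‖utilde - ubar‖ ^ 2 ≤ ‖ι (ptilde - pT)‖ * ‖utilde - ubar‖ := by
      have hVI' := hVI utilde hutilde_mem
      have hCS := real_inner_le_norm (ι (ptilde - pT)) (utilde - ubar)
      rw [← neg_sub utilde ubar, inner_neg_right] at hproj
      rw [← real_inner_self_eq_norm_sq]
      simp only [map_sub, inner_add_left, inner_sub_left, real_inner_smul_left] at *
      linarith
    rcases (norm_nonneg (utilde - ubar)).eq_or_lt with h0 | h0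
    · rw [← h0, mul_zero]
      exact norm_nonneg _
    · exact le_of_mul_le_mul_right (by linarith) h0
  have hstate_diff : ‖ι (ytilde - yhat)‖ ≤ 3 / κ * ηct := by
    rw [hηct, norm_sub_rev uT]
    refine norm_le_of_infsup hκ hOmR hι hinfsupB fun v => ?_
    rw [map_sub, LinearMap.sub_apply, hytilde, hyhat, ← inner_sub_left, add_sub_add_left_eq_sub]
  have hadjoint_diff : ‖ι (ptilde - phat)‖ ≤ 3 / κ * ‖ι (ytilde - yT)‖ := by
    refine norm_le_of_infsup hκ hOmR hι hinfsupBstar fun v => ?_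
    rw [map_sub, LinearMap.sub_apply, hptilde, hphat, ← inner_sub_left, map_sub ι ytilde,
      sub_sub_sub_cancel_right]
  have hstate_err : ‖ι (ytilde - yT)‖ ≤ 3 / κ * ηct + (Real.sqrt κ)⁻¹ * Ast := by
    rw [← sub_add_sub_cancel ytilde yhat yT, map_add]
    exact (norm_add_le _ _).trans (add_le_add hstate_diff (hιR _ _ hAst))
  have hadjoint_err : ‖ι (ptilde - pT)‖
      ≤ 3 / κ * ‖ι (ytilde - yT)‖ + (Real.sqrt κ)⁻¹ * Aad := by
    rw [← sub_add_sub_cancel ptilde phat pT, map_add]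
    exact (norm_add_le _ _).trans (add_le_add hadjoint_diff (hιR _ _ hAad))
  have hstate_sq : ‖ι (ytilde - yT)‖ ^ 2 ≤ 2 * (9 / κ ^ 2 * ηct ^ 2 + κ⁻¹ * Ast ^ 2) := by
    calc _ ≤ (3 / κ * ηct + (Real.sqrt κ)⁻¹ * Ast) ^ 2 := by gcongr
      _ ≤ 2 * ((3 / κ * ηct) ^ 2 + ((Real.sqrt κ)⁻¹ * Ast) ^ 2) := add_sq_le
      _ = _ := by rw [mul_pow, mul_pow, hsq]; ring
  have hadjoint_sq : ‖ι (ptilde - pT)‖ ^ 2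
      ≤ 2 * (9 / κ ^ 2 * ‖ι (ytilde - yT)‖ ^ 2 + κ⁻¹ * Aad ^ 2) := by
    calc _ ≤ (3 / κ * ‖ι (ytilde - yT)‖ + (Real.sqrt κ)⁻¹ * Aad) ^ 2 := by gcongr
      _ ≤ 2 * ((3 / κ * ‖ι (ytilde - yT)‖) ^ 2 + ((Real.sqrt κ)⁻¹ * Aad) ^ 2) := add_sq_le
      _ = _ := by rw [mul_pow, mul_pow, hsq]; ring
  have hcontrol_sq : ‖utilde - ubar‖ ^ 2 ≤ ‖ι (ptilde - pT)‖ ^ 2 / ϑ ^ 2 := by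
    rw [le_div_iff₀ (by positivity), ← mul_pow, mul_comm]
    gcongr
  have htri : ‖ubar - uT‖ ≤ ‖utilde - ubar‖ + ηct := by
    rw [hηct, norm_sub_rev utilde, norm_sub_rev uT]
    exact norm_sub_le_norm_sub_add_norm_sub _ _ _
  calc ‖ubar - uT‖ ^ 2 ≤ (‖utilde - ubar‖ + ηct) ^ 2 := by gcongr
    _ ≤ 2 * (‖utilde - ubar‖ ^ 2 + ηct ^ 2) := add_sq_le
    _ ≤ 2 * ((2 * (9 / κ ^ 2 * (2 * (9 / κ ^ 2 * ηct ^ 2 + κ⁻¹ * Ast ^ 2)) + κ⁻¹ * Aad ^ 2))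
          / ϑ ^ 2 + ηct ^ 2) := by
      gcongr
      refine hcontrol_sq.trans ?_
      gcongr
      refine hadjoint_sq.trans ?_
      gcongr
    _ = _ := by field_simp; ring
end

section
/- In the abstract robust setting, let A_st, A_ad ≥ 0 satisfy ‖ŷ − y_T‖_R ≤ A_st and ‖p̂ − p_T‖_R ≤ A_ad. Then the error in the state satisfies ‖ȳ − y_T‖_R² ≤ (18/κ)(2 + 648/(ϑ²κ⁴)) η_ct² + (72/(ϑ²κ²)) A_ad² + (2 + 1296/(ϑ²κ⁴)) A_st². -/
open MeasureTheory
open scoped InnerProductSpace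

/-- The pointwise clamp to `[a, b]` satisfies the variational inequality that characterizes the
`L²`-projection onto the set of functions with values in `[a, b]`. -/
theorem inner_sub_clamp_nonpos {Ω : Type*} [MeasurableSpace Ω] {μ : Measure Ω} {a b : ℝ}
    (hab : a ≤ b) {w c u : Lp ℝ 2 μ} (hc : c =ᵐ[μ] fun x => min b (max a (w x)))
    (hu : ∀ᵐ x ∂μ, a ≤ u x ∧ u x ≤ b) : ⟪w - c, u - c⟫_ℝ ≤ 0 := by
  rw [L2.inner_def]
  refine integral_nonpos_of_ae ?_
  filter_upwards [hc, hu, Lp.coeFn_sub w c, Lp.coeFn_sub u c] with x hcx hux hwc huc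
  simp only [hwc, huc, Pi.sub_apply, hcx, RCLike.inner_apply, conj_trivial,
    Pi.zero_apply]
  obtain ⟨hau, hub⟩ := hux
  rcases le_total (w x) a with hwa | hwa
  · rw [max_eq_left hwa, min_eq_right hab]
    nlinarith
  · rw [max_eq_right hwa]
    rcases le_total (w x) b with hwb | hwb
    · rw [min_eq_right hwb]
      simp
    · rw [min_eq_left hwb]
      nlinarith

theorem nonneg_of_subadditive_of_abs_homogeneous {V : Type*} [AddCommGroup V] [Module ℝ V]
    {N : V → ℝ} (hadd : ∀ v w, N (v + w) ≤ N v + N w)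
    (hsmul : ∀ (c : ℝ) v, N (c • v) = |c| * N v) (v : V) : 0 ≤ N v := by
  have hzero := hsmul 0 v
  have hneg := hsmul (-1) v
  have h := hadd v ((-1 : ℝ) • v)
  simp only [zero_smul, abs_zero, zero_mul, neg_smul, one_smul, abs_neg, abs_one, one_mul,
    add_neg_cancel] at hzero hneg h
  linarith

/-- Stability of the variational problem `B w v = ⟪g, ι v⟫` under an inf-sup condition. -/
theorem stability_of_infSup {V H : Type*} [AddCommGroup V] [Module ℝ V]
    [NormedAddCommGroup H] [InnerProductSpace ℝ H] {NOm NR : V → ℝ} {s C : ℝ}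
    {ι : V →ₗ[ℝ] H} (hι : ∀ v, ‖ι v‖ ≤ s * NOm v) {B : V →ₗ[ℝ] V →ₗ[ℝ] ℝ}
    (hB : ∀ w : V, ∀ c : ℝ, (∀ v : V, B w v ≤ c * NOm v) → NR w ≤ C * c)
    {w : V} {g : H} (hw : ∀ v, B w v = ⟪g, ι v⟫_ℝ) : NR w ≤ C * (‖g‖ * s) := by
  refine hB w _ fun v => ?_
  rw [hw, mul_assoc]
  exact (real_inner_le_norm _ _).trans (mul_le_mul_of_nonneg_left (hι v) (norm_nonneg g))

theorem sq_le_two_mul_add_sq {x y z : ℝ} (hx : 0 ≤ x) (h : x ≤ y + z) :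
    x ^ 2 ≤ 2 * y ^ 2 + 2 * z ^ 2 := by
  nlinarith [sq_nonneg (y - z), pow_le_pow_left₀ hx h 2]

/-- Combination of the squared estimates: `Y` and `Z` stand for squared state errors, `U` and `D` for
squared control errors, `P` for a squared adjoint error and `I` for a squared `L²` state error. -/
theorem le_of_sq_estimates {κ ϑ Y U D P I Z η Ast Aad : ℝ} (hκ : 0 < κ) (hϑ : 0 < ϑ)
    (hY : Y ≤ 2 * Ast ^ 2 + 2 * (3 ^ 2 * (U * κ⁻¹))) (hU : U ≤ 2 * η ^ 2 + 2 * D)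
    (hD : ϑ ^ 2 * D ≤ κ⁻¹ * P) (hP : P ≤ 2 * Aad ^ 2 + 2 * (3 ^ 2 * (I * κ⁻¹)))
    (hI : I ≤ κ⁻¹ * Z) (hZ : Z ≤ 2 * Ast ^ 2 + 2 * (3 ^ 2 * (η ^ 2 * κ⁻¹))) :
    Y ≤ 18 / κ * (2 + 648 / (ϑ ^ 2 * κ ^ 4)) * η ^ 2
      + 72 / (ϑ ^ 2 * κ ^ 2) * Aad ^ 2 + (2 + 1296 / (ϑ ^ 2 * κ ^ 4)) * Ast ^ 2 := by
  have hD' : D ≤ (ϑ ^ 2)⁻¹ * (κ⁻¹ * P) := by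
    rwa [le_inv_mul_iff₀ (by positivity)]
  calc Y ≤ 2 * Ast ^ 2 + 2 * (3 ^ 2 * (U * κ⁻¹)) := hY
    _ ≤ 2 * Ast ^ 2 + 2 * (3 ^ 2 * ((2 * η ^ 2 + 2 * ((ϑ ^ 2)⁻¹ * (κ⁻¹ *
          (2 * Aad ^ 2 + 2 * (3 ^ 2 * (κ⁻¹ *
            (2 * Ast ^ 2 + 2 * (3 ^ 2 * (η ^ 2 * κ⁻¹))) * κ⁻¹)))))) * κ⁻¹)) := by
        gcongr
        refine hU.trans ?_
        gcongr
        refine hD'.trans ?_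
        gcongr
        refine hP.trans ?_
        gcongr
        refine hI.trans ?_
        gcongr
    _ = _ := by
        field_simp
        ring

/-- Hilbert-space form of the state error bound: the control constraints enter only through the
variational inequalities satisfied by `ubar` and `utilde`, tested with each other. -/
theorem state_error_bound_of_variational_inequalities
    {V H : Type*} [AddCommGroup V] [Module ℝ V] [NormedAddCommGroup H] [InnerProductSpace ℝ H]
    {κ ϑ : ℝ} (hκ : 0 < κ) (hϑ : 0 < ϑ) {NOm NR : V → ℝ}
    (hNR_add : ∀ v w : V, NR (v + w) ≤ NR v + NR w)
    (hNR_smul : ∀ (c : ℝ) (v : V), NR (c • v) = |c| * NR v)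
    (hOmR : ∀ v : V, NOm v ≤ NR v)
    {ι : V →ₗ[ℝ] H} (hι : ∀ v : V, ‖ι v‖ ≤ (Real.sqrt κ)⁻¹ * NOm v)
    {B Bstar : V →ₗ[ℝ] V →ₗ[ℝ] ℝ} (hBstar : ∀ w v : V, Bstar w v = B v w)
    (hinfsupB : ∀ w : V, ∀ c : ℝ, (∀ v : V, B w v ≤ c * NOm v) → NR w ≤ 3 * c)
    (hinfsupBstar : ∀ w : V, ∀ c : ℝ, (∀ v : V, Bstar w v ≤ c * NOm v) → NR w ≤ 3 * c)
    {f yΩ ubar uT utilde : H} {ybar pbar yT pT yhat phat ytilde ptilde : V}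
    (hstate : ∀ v : V, B ybar v = ⟪f + ubar, ι v⟫_ℝ)
    (hadjoint : ∀ w : V, Bstar pbar w = ⟪ι ybar - yΩ, ι w⟫_ℝ)
    (hVI_bar : 0 ≤ ⟪ι pbar + ϑ • ubar, utilde - ubar⟫_ℝ)
    (hVI_tilde : 0 ≤ ⟪ι pT + ϑ • utilde, ubar - utilde⟫_ℝ)
    {ηct : ℝ} (hηct : ηct = ‖uT - utilde‖)
    (hyhat : ∀ v : V, B yhat v = ⟪f + uT, ι v⟫_ℝ)
    (hphat : ∀ w : V, Bstar phat w = ⟪ι yT - yΩ, ι w⟫_ℝ)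
    (hytilde : ∀ v : V, B ytilde v = ⟪f + utilde, ι v⟫_ℝ)
    (hptilde : ∀ w : V, Bstar ptilde w = ⟪ι ytilde - yΩ, ι w⟫_ℝ)
    {Ast Aad : ℝ} (hAst : NR (yhat - yT) ≤ Ast) (hAad : NR (phat - pT) ≤ Aad) :
    NR (ybar - yT) ^ 2 ≤ 18 / κ * (2 + 648 / (ϑ ^ 2 * κ ^ 4)) * ηct ^ 2
      + 72 / (ϑ ^ 2 * κ ^ 2) * Aad ^ 2 + (2 + 1296 / (ϑ ^ 2 * κ ^ 4)) * Ast ^ 2 := by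
  set s : ℝ := (Real.sqrt κ)⁻¹ with hs
  have hs0 : 0 ≤ s := by positivity
  have hs2 : s ^ 2 = κ⁻¹ := by rw [hs, inv_pow, Real.sq_sqrt hκ.le]
  have hNR0 := nonneg_of_subadditive_of_abs_homogeneous hNR_add hNR_smul
  have hιR (v : V) : ‖ι v‖ ≤ s * NR v :=
    (hι v).trans (mul_le_mul_of_nonneg_left (hOmR v) hs0)
  have hNR_tri (x y z : V) : NR (x - z) ≤ NR (y - z) + NR (x - y) := by
    simpa using hNR_add (y - z) (x - y)
  have hmonotone : ⟪ι (pbar - ptilde), utilde - ubar⟫_ℝ ≤ 0 := by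
    have h1 : B (ytilde - ybar) (pbar - ptilde) = ⟪utilde - ubar, ι (pbar - ptilde)⟫_ℝ := by
      rw [map_sub B, LinearMap.sub_apply, hytilde, hstate, ← inner_sub_left,
        add_sub_add_left_eq_sub]
    have h2 : Bstar (pbar - ptilde) (ytilde - ybar) = -‖ι (ytilde - ybar)‖ ^ 2 := by
      rw [map_sub Bstar, LinearMap.sub_apply, hadjoint, hptilde, ← inner_sub_left,
        sub_sub_sub_cancel_right, ← map_sub, ← real_inner_self_eq_norm_sq, ← inner_neg_left,
        ← map_neg, neg_sub]
    rw [real_inner_comm, ← h1, ← hBstar, h2]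
    exact neg_nonpos.mpr (sq_nonneg _)
  have hcontrol : ϑ * ‖utilde - ubar‖ ≤ s * NR (ptilde - pT) := by
    have hsq : ϑ * ‖utilde - ubar‖ ^ 2 ≤ ⟪ι (ptilde - pT), utilde - ubar⟫_ℝ := by
      rw [← real_inner_self_eq_norm_sq]
      simp only [map_sub, inner_add_left, inner_sub_left, inner_sub_right,
        real_inner_smul_left] at hVI_bar hVI_tilde hmonotone ⊢
      linarith [real_inner_comm ubar utilde]
    have hle := hsq.trans (real_inner_le_norm _ _)
    refine le_trans ?_ (hιR _)
    rcases (norm_nonneg (utilde - ubar)).eq_or_lt with h0 | hpos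
    · simp [← h0]
    · refine le_of_mul_le_mul_right ?_ hpos
      linarith
  have hstate_err : NR (ybar - yhat) ≤ 3 * (‖ubar - uT‖ * s) :=
    stability_of_infSup hι hinfsupB fun v => by
      rw [map_sub B, LinearMap.sub_apply, hstate, hyhat, ← inner_sub_left,
        add_sub_add_left_eq_sub]
  have hstate_tilde : NR (ytilde - yhat) ≤ 3 * (ηct * s) := by
    rw [hηct, norm_sub_rev]
    exact stability_of_infSup hι hinfsupB fun v => by
      rw [map_sub B, LinearMap.sub_apply, hytilde, hyhat, ← inner_sub_left,
        add_sub_add_left_eq_sub]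
  have hadjoint_tilde : NR (ptilde - phat) ≤ 3 * (‖ι (ytilde - yT)‖ * s) :=
    stability_of_infSup hι hinfsupBstar fun v => by
      rw [map_sub Bstar, LinearMap.sub_apply, hptilde, hphat, ← inner_sub_left,
        sub_sub_sub_cancel_right, ← map_sub]
  have hubar : ‖ubar - uT‖ ≤ ηct + ‖utilde - ubar‖ := by
    rw [hηct, norm_sub_rev uT, norm_sub_rev utilde ubar, add_comm]
    exact norm_sub_le_norm_sub_add_norm_sub _ _ _
  have hY : NR (ybar - yT) ^ 2 ≤ 2 * Ast ^ 2 + 2 * (3 * (‖ubar - uT‖ * s)) ^ 2 :=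
    sq_le_two_mul_add_sq (hNR0 _) ((hNR_tri _ yhat _).trans (add_le_add hAst hstate_err))
  have hYt : NR (ytilde - yT) ^ 2 ≤ 2 * Ast ^ 2 + 2 * (3 * (ηct * s)) ^ 2 :=
    sq_le_two_mul_add_sq (hNR0 _) ((hNR_tri _ yhat _).trans (add_le_add hAst hstate_tilde))
  have hP : NR (ptilde - pT) ^ 2 ≤ 2 * Aad ^ 2 + 2 * (3 * (‖ι (ytilde - yT)‖ * s)) ^ 2 :=
    sq_le_two_mul_add_sq (hNR0 _) ((hNR_tri _ phat _).trans (add_le_add hAad hadjoint_tilde))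
  have hU : ‖ubar - uT‖ ^ 2 ≤ 2 * ηct ^ 2 + 2 * ‖utilde - ubar‖ ^ 2 :=
    sq_le_two_mul_add_sq (norm_nonneg _) hubar
  have hD := pow_le_pow_left₀ (by positivity) hcontrol 2
  have hI := pow_le_pow_left₀ (norm_nonneg _) (hιR (ytilde - yT)) 2
  simp only [mul_pow, hs2] at hY hYt hP hD hI
  exact le_of_sq_estimates hκ hϑ hY hU hD hP hI hYt

/-- In the abstract robust setting, with `A_st, A_ad ≥ 0` such that
`‖ŷ − y_T‖_R ≤ A_st` and `‖p̂ − p_T‖_R ≤ A_ad`, the error in the state satisfies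
`‖ȳ − y_T‖_R² ≤ (18/κ)(2 + 648/(ϑ²κ⁴)) η_ct² + (72/(ϑ²κ²)) A_ad² + (2 + 1296/(ϑ²κ⁴)) A_st²`. -/
theorem robust_state_error_bound
    {Ω : Type*} [MeasurableSpace Ω] (μ : Measure Ω) [IsFiniteMeasure μ]
    (a b : ℝ) (hab : a < b)
    (Pi : Lp ℝ 2 μ → Lp ℝ 2 μ)
    (hPi : ∀ w : Lp ℝ 2 μ, (⇑(Pi w)) =ᵐ[μ] fun x => min b (max a (w x)))
    (κ ϑ : ℝ) (hκ : 0 < κ) (hϑ : 0 < ϑ)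
    {V : Type*} [AddCommGroup V] [Module ℝ V]
    (NOm NR : V → ℝ)
    (hNOm_add : ∀ v w : V, NOm (v + w) ≤ NOm v + NOm w)
    (hNOm_smul : ∀ (c : ℝ) (v : V), NOm (c • v) = |c| * NOm v)
    (hNOm_eq_zero : ∀ v : V, NOm v = 0 ↔ v = 0)
    (hNR_add : ∀ v w : V, NR (v + w) ≤ NR v + NR w)
    (hNR_smul : ∀ (c : ℝ) (v : V), NR (c • v) = |c| * NR v)
    (hNR_eq_zero : ∀ v : V, NR v = 0 ↔ v = 0)
    (hOmR : ∀ v : V, NOm v ≤ NR v)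
    (ι : V →ₗ[ℝ] Lp ℝ 2 μ)
    (hι : ∀ v : V, ‖ι v‖ ≤ (Real.sqrt κ)⁻¹ * NOm v)
    (B Bstar : V →ₗ[ℝ] V →ₗ[ℝ] ℝ)
    (hBstar : ∀ w v : V, Bstar w v = B v w)
    (hinfsupB : ∀ w : V, ∀ c : ℝ, (∀ v : V, B w v ≤ c * NOm v) → NR w ≤ 3 * c)
    (hinfsupBstar : ∀ w : V, ∀ c : ℝ, (∀ v : V, Bstar w v ≤ c * NOm v) → NR w ≤ 3 * c)
    (f yΩ : Lp ℝ 2 μ)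
    (ybar pbar : V) (ubar : Lp ℝ 2 μ)
    (hubar_mem : ∀ᵐ x ∂μ, a ≤ ubar x ∧ ubar x ≤ b)
    (hstate : ∀ v : V, B ybar v = ⟪f + ubar, ι v⟫_ℝ)
    (hadjoint : ∀ w : V, Bstar pbar w = ⟪ι ybar - yΩ, ι w⟫_ℝ)
    (hVI : ∀ u : Lp ℝ 2 μ, (∀ᵐ x ∂μ, a ≤ u x ∧ u x ≤ b) →
        0 ≤ ⟪ι pbar + ϑ • ubar, u - ubar⟫_ℝ)
    (yT pT : V) (uT : Lp ℝ 2 μ)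
    (huT_mem : ∀ᵐ x ∂μ, a ≤ uT x ∧ uT x ≤ b)
    (utilde : Lp ℝ 2 μ) (hutilde : utilde = Pi (-ϑ⁻¹ • ι pT))
    (ηct : ℝ) (hηct : ηct = ‖uT - utilde‖)
    (yhat phat ytilde ptilde : V)
    (hyhat : ∀ v : V, B yhat v = ⟪f + uT, ι v⟫_ℝ)
    (hphat : ∀ w : V, Bstar phat w = ⟪ι yT - yΩ, ι w⟫_ℝ)
    (hytilde : ∀ v : V, B ytilde v = ⟪f + utilde, ι v⟫_ℝ)
    (hptilde : ∀ w : V, Bstar ptilde w = ⟪ι ytilde - yΩ, ι w⟫_ℝ)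
    (Ast Aad : ℝ) (hAst0 : 0 ≤ Ast) (hAad0 : 0 ≤ Aad)
    (hAst : NR (yhat - yT) ≤ Ast) (hAad : NR (phat - pT) ≤ Aad) :
    NR (ybar - yT) ^ 2 ≤ 18 / κ * (2 + 648 / (ϑ ^ 2 * κ ^ 4)) * ηct ^ 2
      + 72 / (ϑ ^ 2 * κ ^ 2) * Aad ^ 2 + (2 + 1296 / (ϑ ^ 2 * κ ^ 4)) * Ast ^ 2 := by
  have hutilde_mem : ∀ᵐ x ∂μ, a ≤ utilde x ∧ utilde x ≤ b := by
    rw [hutilde]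
    filter_upwards [hPi (-ϑ⁻¹ • ι pT)] with x hx
    rw [hx]
    exact ⟨le_min hab.le (le_max_left _ _), min_le_left _ _⟩
  have hVI_tilde : 0 ≤ ⟪ι pT + ϑ • utilde, ubar - utilde⟫_ℝ := by
    have h := inner_sub_clamp_nonpos hab.le (hPi (-ϑ⁻¹ • ι pT)) hubar_mem
    rw [← hutilde] at h
    have heq : ι pT + ϑ • utilde = -ϑ • (-ϑ⁻¹ • ι pT - utilde) := by
      rw [smul_sub, smul_smul, neg_mul_neg, mul_inv_cancel₀ hϑ.ne', one_smul, neg_smul,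
        sub_neg_eq_add]
    rw [heq, real_inner_smul_left]
    nlinarith
  exact state_error_bound_of_variational_inequalities hκ hϑ hNR_add hNR_smul hOmR hι hBstar
    hinfsupB hinfsupBstar hstate hadjoint (hVI utilde hutilde_mem) hVI_tilde hηct hyhat hphat
    hytilde hptilde hAst hAad
end

section
/- In the abstract robust setting, assume additionally that D_p > 0 and E_ad, osc_ad ≥ 0 satisfy E_ad ≤ D_p (‖p̂ − p_T‖_R + osc_ad). Then the adjoint estimator is efficient: E_ad² ≤ 3 D_p² ((9/κ²) ‖ȳ − y_T‖_R² + ‖p̄ − p_T‖_R² + osc_ad²). -/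
open MeasureTheory
open scoped InnerProductSpace

/-- In the abstract robust setting, if `D_p > 0` and `E_ad, osc_ad ≥ 0` satisfy
`E_ad ≤ D_p (‖p̂ − p_T‖_R + osc_ad)`, then the adjoint estimator is efficient:
`E_ad² ≤ 3 D_p² ((9/κ²) ‖ȳ − y_T‖_R² + ‖p̄ − p_T‖_R² + osc_ad²)`. -/
theorem robust_adjoint_estimator_efficiency
    {Ω : Type*} [MeasurableSpace Ω] (μ : Measure Ω) [IsFiniteMeasure μ]
    (a b : ℝ) (hab : a < b)
    (Pi : Lp ℝ 2 μ → Lp ℝ 2 μ)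
    (hPi : ∀ w : Lp ℝ 2 μ, (⇑(Pi w)) =ᵐ[μ] fun x => min b (max a (w x)))
    (κ ϑ : ℝ) (hκ : 0 < κ) (hϑ : 0 < ϑ)
    {V : Type*} [AddCommGroup V] [Module ℝ V]
    (NOm NR : V → ℝ)
    (hNOm_add : ∀ v w : V, NOm (v + w) ≤ NOm v + NOm w)
    (hNOm_smul : ∀ (c : ℝ) (v : V), NOm (c • v) = |c| * NOm v)
    (hNOm_eq_zero : ∀ v : V, NOm v = 0 ↔ v = 0)
    (hNR_add : ∀ v w : V, NR (v + w) ≤ NR v + NR w)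
    (hNR_smul : ∀ (c : ℝ) (v : V), NR (c • v) = |c| * NR v)
    (hNR_eq_zero : ∀ v : V, NR v = 0 ↔ v = 0)
    (hOmR : ∀ v : V, NOm v ≤ NR v)
    (ι : V →ₗ[ℝ] Lp ℝ 2 μ)
    (hι : ∀ v : V, ‖ι v‖ ≤ (Real.sqrt κ)⁻¹ * NOm v)
    (B Bstar : V →ₗ[ℝ] V →ₗ[ℝ] ℝ)
    (hBstar : ∀ w v : V, Bstar w v = B v w)
    (hinfsupB : ∀ w : V, ∀ c : ℝ, (∀ v : V, B w v ≤ c * NOm v) → NR w ≤ 3 * c)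
    (hinfsupBstar : ∀ w : V, ∀ c : ℝ, (∀ v : V, Bstar w v ≤ c * NOm v) → NR w ≤ 3 * c)
    (f yΩ : Lp ℝ 2 μ)
    (ybar pbar : V) (ubar : Lp ℝ 2 μ)
    (hubar_mem : ∀ᵐ x ∂μ, a ≤ ubar x ∧ ubar x ≤ b)
    (hstate : ∀ v : V, B ybar v = ⟪f + ubar, ι v⟫_ℝ)
    (hadjoint : ∀ w : V, Bstar pbar w = ⟪ι ybar - yΩ, ι w⟫_ℝ)
    (hVI : ∀ u : Lp ℝ 2 μ, (∀ᵐ x ∂μ, a ≤ u x ∧ u x ≤ b) →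
        0 ≤ ⟪ι pbar + ϑ • ubar, u - ubar⟫_ℝ)
    (yT pT : V) (uT : Lp ℝ 2 μ)
    (huT_mem : ∀ᵐ x ∂μ, a ≤ uT x ∧ uT x ≤ b)
    (utilde : Lp ℝ 2 μ) (hutilde : utilde = Pi (-ϑ⁻¹ • ι pT))
    (ηct : ℝ) (hηct : ηct = ‖uT - utilde‖)
    (yhat phat ytilde ptilde : V)
    (hyhat : ∀ v : V, B yhat v = ⟪f + uT, ι v⟫_ℝ)
    (hphat : ∀ w : V, Bstar phat w = ⟪ι yT - yΩ, ι w⟫_ℝ)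
    (hytilde : ∀ v : V, B ytilde v = ⟪f + utilde, ι v⟫_ℝ)
    (hptilde : ∀ w : V, Bstar ptilde w = ⟪ι ytilde - yΩ, ι w⟫_ℝ)
    (Dp Ead oscad : ℝ) (hDp : 0 < Dp) (hEad0 : 0 ≤ Ead) (hosc0 : 0 ≤ oscad)
    (hEad : Ead ≤ Dp * (NR (phat - pT) + oscad)) :
    Ead ^ 2 ≤ 3 * Dp ^ 2 * (9 / κ ^ 2 * NR (ybar - yT) ^ 2 + NR (pbar - pT) ^ 2 + oscad ^ 2) := by
  have hsqrt : 0 < (Real.sqrt κ)⁻¹ := inv_pos.mpr (Real.sqrt_pos.mpr hκ)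
  have hNOm_nonneg : ∀ v : V, 0 ≤ NOm v := fun v =>
    nonneg_of_mul_nonneg_right ((norm_nonneg _).trans (hι v)) hsqrt
  have hsq : (Real.sqrt κ)⁻¹ * (Real.sqrt κ)⁻¹ = κ⁻¹ := by
    rw [← mul_inv, Real.mul_self_sqrt hκ.le]
  have hphat_sub : NR (phat - pbar) ≤ 3 * (κ⁻¹ * NR (ybar - yT)) := by
    refine hinfsupBstar _ _ fun v => ?_
    have hB : Bstar (phat - pbar) v = ⟪-ι (ybar - yT), ι v⟫_ℝ := by
      rw [map_sub, LinearMap.sub_apply, hphat, hadjoint, ← inner_sub_left, map_sub]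
      congr 1
      abel
    calc Bstar (phat - pbar) v = ⟪-ι (ybar - yT), ι v⟫_ℝ := hB
      _ ≤ ‖ι (ybar - yT)‖ * ‖ι v‖ := by
        simpa only [norm_neg] using real_inner_le_norm (-ι (ybar - yT)) (ι v)
      _ ≤ ((Real.sqrt κ)⁻¹ * NOm (ybar - yT)) * ((Real.sqrt κ)⁻¹ * NOm v) :=
        mul_le_mul (hι _) (hι _) (norm_nonneg _) (mul_nonneg hsqrt.le (hNOm_nonneg _))
      _ = κ⁻¹ * NOm (ybar - yT) * NOm v := by rw [← hsq]; ring
      _ ≤ κ⁻¹ * NR (ybar - yT) * NOm v :=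
        mul_le_mul_of_nonneg_right
          (mul_le_mul_of_nonneg_left (hOmR _) (inv_pos.mpr hκ).le) (hNOm_nonneg v)
  have htri : NR (phat - pT) ≤ NR (phat - pbar) + NR (pbar - pT) := by
    simpa only [sub_add_sub_cancel] using hNR_add (phat - pbar) (pbar - pT)
  set s := 3 * (κ⁻¹ * NR (ybar - yT)) with hs
  set t := NR (pbar - pT)
  have hE : Ead ≤ Dp * (s + t + oscad) :=
    hEad.trans (mul_le_mul_of_nonneg_left (by linarith) hDp.le)
  calc Ead ^ 2 ≤ (Dp * (s + t + oscad)) ^ 2 := pow_le_pow_left₀ hEad0 hE 2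
    _ = Dp ^ 2 * (s + t + oscad) ^ 2 := mul_pow _ _ _
    _ ≤ Dp ^ 2 * (3 * (s ^ 2 + t ^ 2 + oscad ^ 2)) :=
      mul_le_mul_of_nonneg_left
        (by nlinarith [sq_nonneg (s - t), sq_nonneg (s - oscad), sq_nonneg (t - oscad)])
        (sq_nonneg _)
    _ = 3 * Dp ^ 2 * (9 / κ ^ 2 * NR (ybar - yT) ^ 2 + t ^ 2 + oscad ^ 2) := by
      rw [hs]; ring
end

section
/- In the abstract robust setting, assume additionally that ū = Π(−ϑ⁻¹ ι p̄). Then the control estimator is efficient: η_ct² = ‖u_T − Π(−ϑ⁻¹ ι p_T)‖_H² ≤ 2 ‖ū − u_T‖_H² + (4/(ϑ²κ)) ‖p̄ − p_T‖_R². -/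
open MeasureTheory
open scoped InnerProductSpace

/-- The pointwise projection onto the interval `[a, b]` is nonexpansive on `L²`. -/
theorem norm_clamp_sub_clamp_le
    {Ω : Type*} [MeasurableSpace Ω] {μ : Measure Ω} {a b : ℝ}
    {P : Lp ℝ 2 μ → Lp ℝ 2 μ}
    (hP : ∀ w : Lp ℝ 2 μ, (⇑(P w)) =ᵐ[μ] fun x => min b (max a (w x)))
    (v w : Lp ℝ 2 μ) : ‖P v - P w‖ ≤ ‖v - w‖ := by
  apply Lp.norm_le_norm_of_ae_le
  filter_upwards [hP v, hP w, Lp.coeFn_sub (P v) (P w), Lp.coeFn_sub v w]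
    with x hv hw hPvw hvw
  rw [hPvw, hvw, Pi.sub_apply, Pi.sub_apply, hv, hw, Real.norm_eq_abs, Real.norm_eq_abs,
    min_comm b, min_comm b, max_comm a, max_comm a]
  exact (abs_min_sub_min_le_max _ _ _ _).trans
    (by simpa using abs_max_sub_max_le_abs (v x) (w x) a)

/-- In the abstract robust setting, if additionally `ū = Π(−ϑ⁻¹ ι p̄)`, then
the control estimator is efficient:
`η_ct² = ‖u_T − Π(−ϑ⁻¹ ι p_T)‖² ≤ 2 ‖ū − u_T‖² + (4/(ϑ²κ)) ‖p̄ − p_T‖_R²`. -/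
theorem robust_control_estimator_efficiency
    {Ω : Type*} [MeasurableSpace Ω] (μ : Measure Ω) [IsFiniteMeasure μ]
    (a b : ℝ) (hab : a < b)
    (Pi : Lp ℝ 2 μ → Lp ℝ 2 μ)
    (hPi : ∀ w : Lp ℝ 2 μ, (⇑(Pi w)) =ᵐ[μ] fun x => min b (max a (w x)))
    (κ ϑ : ℝ) (hκ : 0 < κ) (hϑ : 0 < ϑ)
    {V : Type*} [AddCommGroup V] [Module ℝ V]
    (NOm NR : V → ℝ)
    (hNOm_add : ∀ v w : V, NOm (v + w) ≤ NOm v + NOm w)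
    (hNOm_smul : ∀ (c : ℝ) (v : V), NOm (c • v) = |c| * NOm v)
    (hNOm_eq_zero : ∀ v : V, NOm v = 0 ↔ v = 0)
    (hNR_add : ∀ v w : V, NR (v + w) ≤ NR v + NR w)
    (hNR_smul : ∀ (c : ℝ) (v : V), NR (c • v) = |c| * NR v)
    (hNR_eq_zero : ∀ v : V, NR v = 0 ↔ v = 0)
    (hOmR : ∀ v : V, NOm v ≤ NR v)
    (ι : V →ₗ[ℝ] Lp ℝ 2 μ)
    (hι : ∀ v : V, ‖ι v‖ ≤ (Real.sqrt κ)⁻¹ * NOm v)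
    (B Bstar : V →ₗ[ℝ] V →ₗ[ℝ] ℝ)
    (hBstar : ∀ w v : V, Bstar w v = B v w)
    (hinfsupB : ∀ w : V, ∀ c : ℝ, (∀ v : V, B w v ≤ c * NOm v) → NR w ≤ 3 * c)
    (hinfsupBstar : ∀ w : V, ∀ c : ℝ, (∀ v : V, Bstar w v ≤ c * NOm v) → NR w ≤ 3 * c)
    (f yΩ : Lp ℝ 2 μ)
    (ybar pbar : V) (ubar : Lp ℝ 2 μ)
    (hubar_mem : ∀ᵐ x ∂μ, a ≤ ubar x ∧ ubar x ≤ b)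
    (hstate : ∀ v : V, B ybar v = ⟪f + ubar, ι v⟫_ℝ)
    (hadjoint : ∀ w : V, Bstar pbar w = ⟪ι ybar - yΩ, ι w⟫_ℝ)
    (hVI : ∀ u : Lp ℝ 2 μ, (∀ᵐ x ∂μ, a ≤ u x ∧ u x ≤ b) →
        0 ≤ ⟪ι pbar + ϑ • ubar, u - ubar⟫_ℝ)
    (yT pT : V) (uT : Lp ℝ 2 μ)
    (huT_mem : ∀ᵐ x ∂μ, a ≤ uT x ∧ uT x ≤ b)
    (utilde : Lp ℝ 2 μ) (hutilde : utilde = Pi (-ϑ⁻¹ • ι pT))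
    (ηct : ℝ) (hηct : ηct = ‖uT - utilde‖)
    (yhat phat ytilde ptilde : V)
    (hyhat : ∀ v : V, B yhat v = ⟪f + uT, ι v⟫_ℝ)
    (hphat : ∀ w : V, Bstar phat w = ⟪ι yT - yΩ, ι w⟫_ℝ)
    (hytilde : ∀ v : V, B ytilde v = ⟪f + utilde, ι v⟫_ℝ)
    (hptilde : ∀ w : V, Bstar ptilde w = ⟪ι ytilde - yΩ, ι w⟫_ℝ)
    (hubar_proj : ubar = Pi (-ϑ⁻¹ • ι pbar)) :
    ηct ^ 2 = ‖uT - Pi (-ϑ⁻¹ • ι pT)‖ ^ 2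
    ∧ ηct ^ 2 ≤ 2 * ‖ubar - uT‖ ^ 2 + 4 / (ϑ ^ 2 * κ) * NR (pbar - pT) ^ 2 := by
  refine ⟨by rw [hηct, hutilde], ?_⟩
  have hproj : ‖ubar - utilde‖ ≤ ϑ⁻¹ * ((Real.sqrt κ)⁻¹ * NR (pbar - pT)) := by
    rw [hubar_proj, hutilde]
    refine (norm_clamp_sub_clamp_le hPi _ _).trans ?_
    rw [← smul_sub, ← map_sub, norm_smul, norm_neg, Real.norm_of_nonneg (by positivity)]
    gcongr
    exact (hι _).trans (by gcongr; exact hOmR _)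
  have htri : ηct ≤ ‖ubar - uT‖ + ‖ubar - utilde‖ := by
    rw [hηct, norm_sub_rev ubar uT]
    exact norm_sub_le_norm_sub_add_norm_sub _ _ _
  have hη : 0 ≤ ηct := hηct ▸ norm_nonneg _
  have hsq : (ϑ⁻¹ * ((Real.sqrt κ)⁻¹ * NR (pbar - pT))) ^ 2
      = 1 / (ϑ ^ 2 * κ) * NR (pbar - pT) ^ 2 := by
    rw [mul_pow, mul_pow, inv_pow, inv_pow, Real.sq_sqrt hκ.le]
    field_simp
  calc ηct ^ 2 ≤ (‖ubar - uT‖ + ‖ubar - utilde‖) ^ 2 := by gcongr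
    _ ≤ 2 * ‖ubar - uT‖ ^ 2 + 2 * ‖ubar - utilde‖ ^ 2 := by
      linarith [add_sq_le (a := ‖ubar - uT‖) (b := ‖ubar - utilde‖)]
    _ ≤ 2 * ‖ubar - uT‖ ^ 2 + 2 * (ϑ⁻¹ * ((Real.sqrt κ)⁻¹ * NR (pbar - pT))) ^ 2 := by gcongr
    _ = 2 * ‖ubar - uT‖ ^ 2 + 2 / (ϑ ^ 2 * κ) * NR (pbar - pT) ^ 2 := by rw [hsq]; ring
    _ ≤ 2 * ‖ubar - uT‖ ^ 2 + 4 / (ϑ ^ 2 * κ) * NR (pbar - pT) ^ 2 := by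
      gcongr
      norm_num
end
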